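/- arXiv:2511.04911 — 2 statements merged into one kernel-verified Lean document; each statement's English description precedes it below -/
import Mathlib

section
/- Let p be a prime and let k ⊆ K and k ⊆ L be subfields of an ambient field F of characteristic p such that both extensions k ⊆ K and k ⊆ L are separable. If K is algebraically independent from L over k, then K is p-independent from L over k in the compositum KL; that is, every subset of K that is p-independent in KL over k remains p-independent in KL over L. -/
/-- The subfield generated by a subfield `k` and a subset `S` of the ambient field. -/
def Subfield.adjoinSet {F : Type*} [Field F] (k : Subfield F) (S : Set F) : Subfield F :=
  Subfield.closure (↑k ∪ S)

/-- The subfield of `p`-th powers of a subfield `K`. -/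
def Subfield.pPow {F : Type*} [Field F] (p : ℕ) (K : Subfield F) : Subfield F :=
  Subfield.closure ((fun x : F => x ^ p) '' (K : Set F))

/-- `K₁` is linearly disjoint from `K₂` over a common subfield `k₀`: every subset of `K₁`
which is `k₀`-linearly independent remains `K₂`-linearly independent. -/
def LinDisjOver {F : Type*} [Field F] (k₀ K₁ K₂ : Subfield F) : Prop :=
  ∀ S : Set F, S ⊆ (K₁ : Set F) →
    LinearIndependent k₀ (Subtype.val : S → F) →
    LinearIndependent K₂ (Subtype.val : S → F)

/-- The extension `k ⊆ K` (in characteristic `p`) is separable if `k` is linearly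
disjoint from `K^p` over `k^p`. -/
def SepExt {F : Type*} [Field F] (p : ℕ) (k K : Subfield F) : Prop :=
  LinDisjOver (k.pPow p) k (K.pPow p)

/-- A subset `B` is algebraically independent over a subfield `k₀` if no element of `B`
is algebraic over the subfield generated by `k₀` and the other elements of `B`. -/
def AlgIndepOver {F : Type*} [Field F] (k₀ : Subfield F) (B : Set F) : Prop :=
  ∀ b ∈ B, ¬ IsAlgebraic (k₀.adjoinSet (B \ {b})) b

/-- `K` is algebraically independent (free) from `L` over `k`: every subset of `K`
algebraically independent over `k` remains algebraically independent over `L`. -/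
def AlgIndepFrom {F : Type*} [Field F] (k K L : Subfield F) : Prop :=
  ∀ S : Set F, S ⊆ (K : Set F) → AlgIndepOver k S → AlgIndepOver L S

/-- A subset `S` of a subfield `M` is `p`-independent in `M` over `k₀` if no `s ∈ S`
lies in the subfield `M^p · k₀(S ∖ {s})`. -/
def PIndepOver {F : Type*} [Field F] (p : ℕ) (k₀ M : Subfield F) (S : Set F) : Prop :=
  ∀ s ∈ S,
    s ∉ Subfield.closure ((fun x : F => x ^ p) '' (M : Set F) ∪ ↑k₀ ∪ (S \ {s}))

open IntermediateField

section

variable {F : Type*} [Field F] {p : ℕ}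

theorem Subfield.adjoinSet_eq_toSubfield_adjoin (k : Subfield F) (S : Set F) :
    k.adjoinSet S = (adjoin k S).toSubfield := by
  have : Set.range (algebraMap k F) = k := Subtype.range_coe
  simp only [Subfield.adjoinSet, adjoin, this]

theorem Subfield.le_adjoinSet (k : Subfield F) (S : Set F) : k ≤ k.adjoinSet S :=
  fun _ h ↦ Subfield.subset_closure (.inl h)

theorem Subfield.subset_adjoinSet (k : Subfield F) (S : Set F) : S ⊆ k.adjoinSet S :=
  fun _ h ↦ Subfield.subset_closure (.inr h)

theorem Subfield.adjoinSet_le {k M : Subfield F} {S : Set F} :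
    k.adjoinSet S ≤ M ↔ k ≤ M ∧ S ⊆ M := by
  simp [Subfield.adjoinSet, Subfield.closure_le]

theorem Subfield.mem_pPow (hp : p.Prime) [CharP F p] {K : Subfield F} {x : F} :
    x ∈ K.pPow p ↔ ∃ y ∈ K, y ^ p = x := by
  have : Fact p.Prime := ⟨hp⟩
  have h : (fun x : F ↦ x ^ p) '' (K : Set F) = K.map (frobenius F p) := by
    ext; simp [frobenius_def]
  rw [Subfield.pPow, h, Subfield.closure_eq]
  simp [frobenius_def]

/-- For `K` separable over `k`, `p`-th powers of `k`-linearly independent elements of `K` are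
`k`-linearly independent. -/
theorem SepExt.linearIndependent_pow (hp : p.Prime) [CharP F p] {k K : Subfield F}
    (hkK : k ≤ K) (h : SepExt p k K) {ι : Type*} [Fintype ι] {x : ι → F} (hxK : ∀ i, x i ∈ K)
    (hx : LinearIndependent k x) : LinearIndependent k fun i ↦ x i ^ p := by
  classical
  have : Fact p.Prime := ⟨hp⟩
  obtain ⟨b, hbk, hspan, hb⟩ := exists_linearIndependent (k.pPow p) (k : Set F)
  have hbK := linearIndependent_iff'.mp (h b hbk hb)
  rw [Fintype.linearIndependent_iff] at hx ⊢
  intro g hg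
  have hmem (i : ι) : (g i : F) ∈ Submodule.span (k.pPow p) b :=
    hspan ▸ Submodule.subset_span (g i).2
  choose c hc using fun i ↦ (Finsupp.mem_span_iff_linearCombination _ _ _).mp (hmem i)
  choose a hak ha using fun i j ↦ (Subfield.mem_pPow hp).mp (c i j).2
  set J : Finset b := Finset.univ.biUnion fun i ↦ (c i).support
  have hc' (i : ι) : (g i : F) = ∑ j ∈ J, a i j ^ p * j := by
    rw [← hc i, Finsupp.linearCombination_apply,
      Finsupp.sum_of_support_subset (s := J) _ (Finset.subset_biUnion_of_mem
        (fun i ↦ (c i).support) (Finset.mem_univ i))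
        _ (by simp)]
    exact Finset.sum_congr rfl fun j _ ↦ by rw [ha]; rfl
  have ha0 (i : ι) (j : b) (hj : j ∈ J) : a i j = 0 := by
    have hsum (j : b) : ∑ i, a i j * x i ∈ K :=
      sum_mem fun i _ ↦ mul_mem (hkK (hak i j)) (hxK i)
    have hrel : ∑ j ∈ J, (∑ i, a i j * x i) ^ p * (j : F) = 0 := by
      simp only [sum_pow_char, mul_pow, Finset.sum_mul]
      rw [Finset.sum_comm, ← hg]
      refine Finset.sum_congr rfl fun i _ ↦ ?_
      rw [Subfield.smul_def, smul_eq_mul, hc', Finset.sum_mul]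
      exact Finset.sum_congr rfl fun j _ ↦ by ring
    have hj0 := hbK J (fun j ↦ ⟨(∑ i, a i j * x i) ^ p, (Subfield.mem_pPow hp).mpr
      ⟨_, hsum j, rfl⟩⟩) hrel j hj
    have := hx (fun i ↦ ⟨a i j, hak i j⟩)
      (pow_eq_zero_iff hp.ne_zero |>.mp (congrArg Subtype.val hj0)) i
    exact congrArg Subtype.val this
  intro i
  ext
  rw [hc' i]
  exact Finset.sum_eq_zero fun j hj ↦ by simp [ha0 i j hj, hp.ne_zero]

end

section

universe u

variable {k : Type*} {K : Type u} [Field k] [Field K] [Algebra k K] {p : ℕ}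

theorem IntermediateField.mem_adjoin_insert_pow_of_isSeparable [ExpChar k p] {S : Set K} {t : K}
    (h : IsSeparable (adjoin k S) t) : t ∈ adjoin k (insert (t ^ p) S) := by
  have : ExpChar (adjoin k S) p := expChar_of_injective_algebraMap (algebraMap k _).injective p
  have ht : t ∈ (adjoin k S)⟮t⟯ := mem_adjoin_simple_self _ t
  rw [adjoin_simple_eq_adjoin_pow_expChar_of_isSeparable _ _ h p, ← mem_restrictScalars k,
    adjoin_adjoin_left] at ht
  simpa [Set.union_comm] using ht

theorem algebraicIndependent_of_notMem_adjoin_insert_pow_of_adjoin_eq_top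
    [ExpChar k p] (hp : p.Prime)
    (H : ∀ s : Finset K, LinearIndepOn k id (s : Set K) → LinearIndepOn k (· ^ p) (s : Set K))
    {T : Set K} (htop : adjoin k T = ⊤)
    (hT : ∀ t ∈ T, t ∉ adjoin k (insert (t ^ p) (T \ {t}))) :
    AlgebraicIndependent k ((↑) : T → K) := by
  have : Algebra.IsAlgebraic (Algebra.adjoin k T) K := by
    rw [← isAlgebraic_adjoin_iff_top, htop, Algebra.isAlgebraic_iff_isIntegral]
    exact Algebra.isIntegral_of_surjective topEquiv.surjective
  obtain ⟨B, hBT, hB⟩ := exists_isTranscendenceBasis_subset (R := k) T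
  obtain rfl | ⟨-, n, hnT, hnB⟩ := hBT.eq_or_ssubset.imp_right Set.ssubset_iff_exists.mp
  · exact hB.1
  obtain ⟨i, hi, hsep⟩ := exists_isTranscendenceBasis_and_isSeparable_of_linearIndepOn_pow'
    p hp H (a := id) B n hB hnB
  rw [Set.image_id] at hsep
  by_cases hiB : i ∈ insert n B
  · have hiT : i ∈ T := Set.insert_subset hnT hBT hiB
    refine (hT i hiT ?_).elim
    refine adjoin.mono _ _ _ (Set.insert_subset_insert ?_)
      (mem_adjoin_insert_pow_of_isSeparable hsep)
    exact Set.sdiff_subset_sdiff_left (Set.insert_subset hnT hBT)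
  · rw [Set.sdiff_singleton_eq_self hiB] at hi
    have := hB.2 (insert n B) hi.1 (by simp)
    rw [Subtype.range_coe] at this
    exact (hnB (this ▸ Set.mem_insert n B)).elim

theorem algebraicIndependent_of_notMem_adjoin_insert_pow
    [ExpChar k p] (hp : p.Prime) {T : Set K}
    (H : ∀ (ι : Type u) [Fintype ι] (x : ι → K), (∀ i, x i ∈ adjoin k T) →
      LinearIndependent k x → LinearIndependent k fun i ↦ x i ^ p)
    (hT : ∀ t ∈ T, t ∉ adjoin k (insert (t ^ p) (T \ {t}))) :
    AlgebraicIndependent k ((↑) : T → K) := by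
  set M := adjoin k T
  have hTM : T ⊆ M := subset_adjoin k T
  set T' : Set M := M.val ⁻¹' T
  have himage : M.val '' T' = T := by
    rw [Set.image_preimage_eq_iff]
    simpa using! hTM
  have hT' : AlgebraicIndependent k ((↑) : T' → M) := by
    refine algebraicIndependent_of_notMem_adjoin_insert_pow_of_adjoin_eq_top hp ?_ ?_ ?_
    · intro s hs
      refine .of_comp M.val.toLinearMap ?_
      exact H s (fun i ↦ (i : M)) (fun i ↦ (i : M).2)
        (hs.map' M.val.toLinearMap (LinearMap.ker_eq_bot.mpr M.val.injective))
    · apply map_injective M.val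
      rw [adjoin_map, himage, ← AlgHom.fieldRange_eq_map, fieldRange_val]
    · intro t ht hmem
      refine hT t ht ?_
      have := Set.mem_image_of_mem M.val hmem
      rw [← coe_map, adjoin_map, Set.image_insert_eq, Set.image_sdiff (f := M.val) M.val.injective,
        himage] at this
      simpa using this
  exact (hT'.map' (f := M.val) M.val.injective).comp
    (fun t : T ↦ (⟨⟨t, hTM t.2⟩, t.2⟩ : T')) fun _ _ h ↦ by simpa [Subtype.ext_iff] using h

end

section

universe u

variable {F : Type u} [Field F] {p : ℕ}

/-- A `p`-independent subset of a separable extension is algebraically independent. -/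
theorem PIndepOver.algIndepOver (hp : p.Prime) [CharP F p] {k K M : Subfield F}
    (hkK : k ≤ K) (hsep : SepExt p k K) {T : Set F} (hTK : T ⊆ K) (hTM : T ⊆ M)
    (hT : PIndepOver p k M T) : AlgIndepOver k T := by
  have : Fact p.Prime := ⟨hp⟩
  have hle : adjoin k T ≤ (K.toIntermediateField fun x ↦ hkK x.2 : IntermediateField k F) :=
    adjoin_le_iff.mpr hTK
  have hind : AlgebraicIndependent k ((↑) : T → F) := by
    refine algebraicIndependent_of_notMem_adjoin_insert_pow (p := p) hp
      (fun ι _ x hx hlin ↦ hsep.linearIndependent_pow hp hkK (fun i ↦ hle (hx i)) hlin) ?_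
    intro t ht hmem
    refine hT t ht ?_
    rw [← mem_toSubfield, ← Subfield.adjoinSet_eq_toSubfield_adjoin] at hmem
    refine Subfield.adjoinSet_le.mpr ⟨fun x hx ↦ ?_, Set.insert_subset ?_ fun x hx ↦ ?_⟩ hmem
    · exact Subfield.subset_closure (.inl (.inr hx))
    · exact Subfield.subset_closure (.inl (.inl ⟨t, hTM ht, rfl⟩))
    · exact Subfield.subset_closure (.inr hx)
  intro t ht halg
  rw [Subfield.adjoinSet_eq_toSubfield_adjoin] at halg
  have htr := hind.transcendental_adjoin (s := {⟨t, ht⟩}ᶜ) (i := ⟨t, ht⟩) (by simp)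
  have himage : ((↑) : T → F) '' {⟨t, ht⟩}ᶜ = T \ {t} := by
    ext x; simp
  rw [himage] at htr
  exact htr (isAlgebraic_adjoin_iff.mp halg)

theorem finrank_adjoin_simple_of_pow_mem (hp : p.Prime) [CharP F p] {N : Subfield F} {x : F}
    (hx : x ∉ N) (hxp : x ^ p ∈ N) : Module.finrank N N⟮x⟯ = p := by
  have : Fact p.Prime := ⟨hp⟩
  have hirr : Irreducible (Polynomial.X ^ p - Polynomial.C (⟨x ^ p, hxp⟩ : N)) := by
    refine X_pow_sub_C_irreducible_of_prime hp fun b hb ↦ hx ?_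
    have : (b : F) = x := frobenius_inj F p (congrArg Subtype.val hb)
    exact this ▸ b.2
  have hmonic := Polynomial.monic_X_pow_sub_C (⟨x ^ p, hxp⟩ : N) hp.ne_zero
  have hroot : Polynomial.aeval x (Polynomial.X ^ p - Polynomial.C (⟨x ^ p, hxp⟩ : N)) = 0 := by
    simp [Algebra.algebraMap_eq_smul_one, Subfield.smul_def]
  rw [adjoin.finrank ⟨_, hmonic, hroot⟩, ← minpoly.eq_of_irreducible_of_monic hirr hroot hmonic,
    Polynomial.natDegree_X_pow_sub_C]

theorem mem_adjoinSet_singleton_symm (hp : p.Prime) [CharP F p] {N : Subfield F} {x t : F}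
    (hxp : x ^ p ∈ N) (htp : t ^ p ∈ N) (ht : t ∉ N) (h : t ∈ N.adjoinSet {x}) :
    x ∈ N.adjoinSet {t} := by
  by_cases hx : x ∈ N
  · exact N.le_adjoinSet _ hx
  rw [Subfield.adjoinSet_eq_toSubfield_adjoin, mem_toSubfield] at h ⊢
  have hdim := finrank_adjoin_simple_of_pow_mem hp hx hxp
  have : FiniteDimensional N N⟮x⟯ := .of_finrank_pos (hdim ▸ hp.pos)
  rw [eq_of_le_of_finrank_eq (adjoin_simple_le_iff.mpr h)
    ((finrank_adjoin_simple_of_pow_mem hp ht htp).trans hdim.symm)]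
  exact mem_adjoin_simple_self _ x

/-- A `p`-independent set can be enlarged by any element outside `M ^ p` adjoined with `k` and `T`. -/
theorem PIndepOver.insert (hp : p.Prime) [CharP F p] {k M : Subfield F} {T : Set F} {x : F}
    (hT : PIndepOver p k M T) (hTM : T ⊆ M) (hxM : x ∈ M)
    (hx : x ∉ Subfield.closure ((fun x : F ↦ x ^ p) '' (M : Set F) ∪ ↑k ∪ T)) :
    PIndepOver p k M (insert x T) := by
  have hxT : x ∉ T := fun h ↦ hx (Subfield.subset_closure (.inr h))
  rintro t (rfl | ht)
  · rwa [Set.insert_sdiff_of_mem _ (Set.mem_singleton t), Set.sdiff_singleton_eq_self hxT]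
  · intro hmem
    have hne : x ≠ t := fun h ↦ hxT (h ▸ ht)
    have hcl (y : F) (A : Set F) : (Subfield.closure A).adjoinSet {y} =
        Subfield.closure (A ∪ {y}) := by
      rw [Subfield.adjoinSet, Subfield.closure_union, Subfield.closure_eq, Subfield.closure_union]
    have hpow {y : F} (hy : y ∈ M) : y ^ p ∈ Subfield.closure
        ((fun x : F ↦ x ^ p) '' (M : Set F) ∪ ↑k ∪ (T \ {t})) :=
      Subfield.subset_closure (.inl (.inl ⟨y, hy, rfl⟩))
    have := mem_adjoinSet_singleton_symm hp (hpow hxM) (hpow (hTM ht)) (hT t ht) (by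
      rwa [hcl, Set.union_assoc, Set.union_singleton, Set.insert_sdiff_singleton_comm hne])
    rw [hcl, Set.union_assoc, Set.sdiff_union_of_subset (by simpa)] at this
    exact hx this

/-- If `E(G)` is generated by its `p`-th powers over `E` and `G` is finite, then `E(G)` is
separable over `E`, since all differentials vanish. -/
theorem isSeparable_of_subset_closure_pow [CharP F p] (E : Subfield F)
    {G : Set F} (hG : G.Finite)
    (h : G ⊆ Subfield.closure ((fun x : F ↦ x ^ p) '' (E.adjoinSet G : Set F) ∪ ↑E)) :
    ∀ g ∈ G, IsSeparable E g := by
  set M := adjoin E G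
  have hfg : Algebra.EssFiniteType E M := essFiniteType_iff.mpr (fg_adjoin_of_finite hG)
  have hle : E.adjoinSet G ≤ Subfield.closure
      ((fun x : F ↦ x ^ p) '' (E.adjoinSet G : Set F) ∪ ↑E) :=
    Subfield.adjoinSet_le.mpr ⟨fun x hx ↦ Subfield.subset_closure (.inr hx), h⟩
  rw [Subfield.adjoinSet_eq_toSubfield_adjoin] at hle
  let D := KaehlerDifferential.D E M
  have hD (x : F) (hx : x ∈ Subfield.closure
      ((fun x : F ↦ x ^ p) '' (M.toSubfield : Set F) ∪ ↑E)) :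
      ∃ y : M, (y : F) = x ∧ D y = 0 := by
    induction hx using Subfield.closure_induction with
    | mem x hx =>
      obtain ⟨y, hy, rfl⟩ | hx := hx
      · exact ⟨⟨y, hy⟩ ^ p, rfl, by
          rw [D.leibniz_pow, ← Nat.cast_smul_eq_nsmul M, CharP.cast_eq_zero, zero_smul]⟩
      · exact ⟨algebraMap E M ⟨x, hx⟩, rfl, D.map_algebraMap _⟩
    | one => exact ⟨1, rfl, D.map_one_eq_zero⟩
    | add x y _ _ hx hy =>
      obtain ⟨⟨a, rfl, ha⟩, ⟨b, rfl, hb⟩⟩ := And.intro hx hy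
      exact ⟨a + b, rfl, by simp [ha, hb]⟩
    | neg x _ hx =>
      obtain ⟨a, rfl, ha⟩ := hx
      exact ⟨-a, rfl, by simp [ha]⟩
    | inv x _ hx =>
      obtain ⟨a, rfl, ha⟩ := hx
      exact ⟨a⁻¹, rfl, by simp [Derivation.leibniz_inv, ha]⟩
    | mul x y _ _ hx hy =>
      obtain ⟨⟨a, rfl, ha⟩, ⟨b, rfl, hb⟩⟩ := And.intro hx hy
      exact ⟨a * b, rfl, by simp [ha, hb]⟩
  have : Algebra.FormallyUnramified E M := by
    refine ⟨Submodule.subsingleton_iff M |>.mp (subsingleton_of_bot_eq_top ?_)⟩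
    rw [← KaehlerDifferential.span_range_derivation, eq_comm, Submodule.span_eq_bot]
    rintro _ ⟨x, rfl⟩
    obtain ⟨y, hyx, hy⟩ := hD x (hle x.2)
    rwa [← Subtype.ext hyx]
  have := Algebra.FormallyUnramified.isSeparable E M
  intro g hg
  exact le_separableClosure E F M (subset_adjoin E G hg)

end

section

variable {F : Type*} [Field F] {p : ℕ}

theorem notMem_adjoin_simple_pow_of_transcendental {k : Type*} [Field k] [Algebra k F]
    (hp : p.Prime) {s : F} (hs : Transcendental k s) : s ∉ k⟮s ^ p⟯ := by
  intro hmem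
  obtain ⟨f, g, hfg⟩ := (mem_adjoin_simple_iff k s).mp hmem
  have hg : Polynomial.aeval (s ^ p) g ≠ 0 := by
    rintro h0
    rw [h0, div_zero] at hfg
    exact hs (hfg ▸ isAlgebraic_zero)
  refine hs ⟨Polynomial.X * Polynomial.expand k p g - Polynomial.expand k p f, fun h0 ↦ hg ?_, ?_⟩
  · suffices g = 0 by simp [this]
    ext n
    have := congrArg (Polynomial.coeff · (p * n + 1)) h0
    have hdvd : ¬ p ∣ p * n + 1 := by
      rw [← Nat.dvd_add_iff_right (dvd_mul_right p n)]
      exact hp.not_dvd_one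
    simpa [Polynomial.coeff_X_mul, Polynomial.coeff_expand hp.pos, hdvd, hp.pos] using this
  · rw [map_sub, map_mul, Polynomial.aeval_X, Polynomial.expand_aeval, Polynomial.expand_aeval,
      sub_eq_zero]
    nth_rw 1 [hfg]
    exact div_mul_cancel₀ _ hg

theorem IsSeparable.of_subfield_ringHom {A B : Subfield F} (φ : F →+* F) (h : ∀ a ∈ A, φ a ∈ B)
    {x : F} (hx : IsSeparable A x) : IsSeparable B (φ x) := by
  let ψ : A →+* B := (φ.comp A.subtype).codRestrict B fun a ↦ h a a.2
  have hx' : (minpoly A x).Separable := hx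
  refine (hx'.map (f := ψ)).of_dvd (minpoly.dvd _ _ ?_)
  have hcomp : (algebraMap B F).comp ψ = φ.comp (algebraMap A F) := rfl
  rw [Polynomial.aeval_def, Polynomial.eval₂_map, hcomp, ← Polynomial.hom_eval₂,
    ← Polynomial.aeval_def, minpoly.aeval, map_zero]

/-- A separating transcendence basis is `p`-independent. -/
theorem AlgIndepOver.pIndepOver_adjoinSet (hp : p.Prime) [CharP F p] {L : Subfield F}
    {T G : Set F} (hT : AlgIndepOver L T) (hG : ∀ g ∈ G, IsSeparable (L.adjoinSet T) g) :
    PIndepOver p L (L.adjoinSet G) T := by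
  have : Fact p.Prime := ⟨hp⟩
  intro s hs hmem
  set N₀ := L.adjoinSet (T \ {s})
  set N := N₀.adjoinSet {s ^ p}
  have hN₀N : N₀ ≤ N := N₀.le_adjoinSet _
  have hspN : s ^ p ∈ N := N₀.subset_adjoinSet _ rfl
  have hLN : L ≤ N := (L.le_adjoinSet _).trans hN₀N
  have hTN : T \ {s} ⊆ N := (L.subset_adjoinSet _).trans hN₀N
  have hfrob : ∀ a ∈ L.adjoinSet T, frobenius F p a ∈ N := by
    refine Subfield.adjoinSet_le (M := N.comap (frobenius F p)) |>.mpr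
      ⟨fun x hx ↦ ?_, fun x hx ↦ ?_⟩
    · exact pow_mem (hLN hx) p
    · obtain rfl | hne := eq_or_ne x s
      · exact hspN
      · exact pow_mem (hTN ⟨hx, hne⟩) p
  have hsepG : L.adjoinSet G ≤ (separableClosure (L.adjoinSet T) F).toSubfield :=
    Subfield.adjoinSet_le.mpr ⟨fun x hx ↦
      isSeparable_algebraMap (K := F) (⟨x, L.le_adjoinSet T hx⟩ : L.adjoinSet T), hG⟩
  have hsN : s ∈ separableClosure N F := by
    refine Subfield.closure_le (t := (separableClosure N F).toSubfield).mpr ?_ hmem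
    have hN (x : F) (hx : x ∈ N) : x ∈ separableClosure N F :=
      isSeparable_algebraMap (K := F) (⟨x, hx⟩ : N)
    refine Set.union_subset (Set.union_subset ?_ fun x hx ↦ hN x (hLN hx)) fun x hx ↦ hN x (hTN hx)
    rintro _ ⟨x, hx, rfl⟩
    exact (mem_separableClosure_iff.mp (hsepG hx)).of_subfield_ringHom (frobenius F p) hfrob
  have hs' : s ∈ N⟮s ^ p⟯ := by
    rw [← adjoin_simple_eq_adjoin_pow_expChar_of_isSeparable N F hsN p]
    exact mem_adjoin_simple_self _ s
  have hsmem : s ∈ N := by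
    have hle : N⟮s ^ p⟯ ≤ ⊥ :=
      adjoin_simple_le_iff.mpr (IntermediateField.algebraMap_mem ⊥ (⟨s ^ p, hspN⟩ : N))
    obtain ⟨x, hx⟩ := mem_bot.mp (hle hs')
    exact hx ▸ x.2
  refine notMem_adjoin_simple_pow_of_transcendental hp (hT _ hs) ?_
  rwa [← mem_toSubfield, ← Subfield.adjoinSet_eq_toSubfield_adjoin]

theorem Subfield.exists_finite_of_mem_closure {A : Set F} {x : F} (hx : x ∈ Subfield.closure A) :
    ∃ B ⊆ A, B.Finite ∧ x ∈ Subfield.closure B := by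
  induction hx using Subfield.closure_induction with
  | mem x hx => exact ⟨{x}, by simpa, Set.finite_singleton x, Subfield.subset_closure rfl⟩
  | one => exact ⟨∅, by simp, Set.finite_empty, one_mem _⟩
  | neg x _ hx => exact hx.imp fun _ ⟨h₁, h₂, h₃⟩ ↦ ⟨h₁, h₂, neg_mem h₃⟩
  | inv x _ hx => exact hx.imp fun _ ⟨h₁, h₂, h₃⟩ ↦ ⟨h₁, h₂, inv_mem h₃⟩
  | add x y _ _ hx hy =>
    obtain ⟨⟨B, hB, hBf, hxB⟩, ⟨C, hC, hCf, hyC⟩⟩ := And.intro hx hy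
    exact ⟨B ∪ C, Set.union_subset hB hC, hBf.union hCf,
      add_mem (Subfield.closure_mono Set.subset_union_left hxB)
        (Subfield.closure_mono Set.subset_union_right hyC)⟩
  | mul x y _ _ hx hy =>
    obtain ⟨⟨B, hB, hBf, hxB⟩, ⟨C, hC, hCf, hyC⟩⟩ := And.intro hx hy
    exact ⟨B ∪ C, Set.union_subset hB hC, hBf.union hCf,
      mul_mem (Subfield.closure_mono Set.subset_union_left hxB)
        (Subfield.closure_mono Set.subset_union_right hyC)⟩

theorem Subfield.adjoinSet_mono (L : Subfield F) {A B : Set F} (h : A ⊆ B) :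
    L.adjoinSet A ≤ L.adjoinSet B :=
  Subfield.closure_mono (Set.union_subset_union_right _ h)

theorem Subfield.exists_finite_of_mem_sup {K L : Subfield F} {x : F} (hx : x ∈ K ⊔ L) :
    ∃ G ⊆ (K : Set F), G.Finite ∧ x ∈ L.adjoinSet G := by
  rw [← Subfield.closure_eq K, ← Subfield.closure_eq L, ← Subfield.closure_union] at hx
  obtain ⟨B, hB, hBf, hxB⟩ := Subfield.exists_finite_of_mem_closure hx
  refine ⟨B ∩ K, Set.inter_subset_right, hBf.inter_of_left _, Subfield.closure_mono ?_ hxB⟩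
  intro y hy
  exact (hB hy).elim (fun h ↦ .inr ⟨hy, h⟩) .inl

theorem exists_finite_of_mem_closure_pow_sup {K L : Subfield F} {S : Set F} (hSK : S ⊆ K) {x : F}
    (hx : x ∈ Subfield.closure ((fun x : F ↦ x ^ p) '' ((K ⊔ L : Subfield F) : Set F) ∪ ↑L ∪ S)) :
    ∃ G ⊆ (K : Set F), G.Finite ∧ x ∈ Subfield.closure
      ((fun x : F ↦ x ^ p) '' (L.adjoinSet G : Set F) ∪ ↑L ∪ (S ∩ G)) := by
  obtain ⟨B, hB, hBf, hxB⟩ := Subfield.exists_finite_of_mem_closure hx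
  have hex (b : F) (hb : b ∈ B) : ∃ G ⊆ (K : Set F), G.Finite ∧ b ∈
      (fun x : F ↦ x ^ p) '' (L.adjoinSet G : Set F) ∪ ↑L ∪ (S ∩ G) := by
    obtain (⟨y, hy, rfl⟩ | hbL) | hbS := hB hb
    · obtain ⟨G, hG, hGf, hyG⟩ := Subfield.exists_finite_of_mem_sup hy
      exact ⟨G, hG, hGf, .inl (.inl ⟨y, hyG, rfl⟩)⟩
    · exact ⟨∅, by simp, Set.finite_empty, .inl (.inr hbL)⟩
    · exact ⟨{b}, by simpa using hSK hbS, Set.finite_singleton b, .inr ⟨hbS, rfl⟩⟩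
  choose! G hGK hGf hG using hex
  refine ⟨⋃ b ∈ B, G b, Set.iUnion₂_subset hGK, hBf.biUnion hGf, Subfield.closure_mono ?_ hxB⟩
  intro b hb
  have hsub : G b ⊆ ⋃ b ∈ B, G b := Set.subset_biUnion_of_mem hb
  exact Set.union_subset_union (Set.union_subset_union_left _ (Set.image_mono
    (L.adjoinSet_mono hsub))) (Set.inter_subset_inter_right _ hsub) (hG b hb)

theorem PIndepOver.mono {k M N : Subfield F} {S T : Set F} (hT : PIndepOver p k N T)
    (hMN : M ≤ N) (hST : S ⊆ T) : PIndepOver p k M S := by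
  refine fun s hs hmem ↦ hT s (hST hs) (Subfield.closure_mono ?_ hmem)
  exact Set.union_subset_union (Set.union_subset_union_left _ (Set.image_mono hMN))
    (Set.sdiff_subset_sdiff_left hST)

end

/-- If `k ⊆ K` and `k ⊆ L` are separable and `K` is algebraically independent from `L`
over `k`, then `K` is `p`-independent from `L` over `k` in the compositum `KL`: every
subset of `K` which is `p`-independent in `KL` over `k` remains `p`-independent
in `KL` over `L`. -/
theorem pIndepFrom_of_algIndepFrom
    {p : ℕ} (hp : p.Prime) {F : Type*} [Field F] [CharP F p]
    (k K L : Subfield F) (hkK : k ≤ K) (hkL : k ≤ L)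
    (hsK : SepExt p k K) (hsL : SepExt p k L) (hfree : AlgIndepFrom k K L) :
    ∀ S : Set F, S ⊆ (K : Set F) →
      PIndepOver p k (K ⊔ L) S → PIndepOver p L (K ⊔ L) S := by
  intro S hSK hS s hs hmem
  obtain ⟨G₀, hG₀K, hG₀f, hsG₀⟩ :=
    exists_finite_of_mem_closure_pow_sup (Set.sdiff_subset.trans hSK) hmem
  set G := insert s G₀
  have hGK : G ⊆ K := Set.insert_subset (hSK hs) hG₀K
  have hGf : G.Finite := hG₀f.insert s
  have hMK : k.adjoinSet G ≤ K := Subfield.adjoinSet_le.mpr ⟨hkK, hGK⟩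
  have hGM : G ⊆ k.adjoinSet G := k.subset_adjoinSet G
  have hfin : {T | T ⊆ G ∧ PIndepOver p k (k.adjoinSet G) T}.Finite :=
    hGf.finite_subsets.subset fun _ h ↦ h.1
  obtain ⟨T, hST, ⟨hTG, hT⟩, hmax⟩ := hfin.exists_le_maximal (a := S ∩ G)
    ⟨Set.inter_subset_right, hS.mono (hMK.trans le_sup_left) Set.inter_subset_left⟩
  have hgen : G ⊆ Subfield.closure
      ((fun x : F ↦ x ^ p) '' ((k.adjoinSet T).adjoinSet G : Set F) ∪ ↑(k.adjoinSet T)) := by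
    intro g hg
    by_contra hg'
    have hg'' : g ∉ Subfield.closure ((fun x : F ↦ x ^ p) '' (k.adjoinSet G : Set F) ∪ ↑k ∪ T) := by
      refine fun h ↦ hg' (Subfield.closure_mono ?_ h)
      rw [Set.union_assoc]
      refine Set.union_subset_union (Set.image_mono ?_) Subfield.subset_closure
      exact Subfield.adjoinSet_le.mpr ⟨(k.le_adjoinSet T).trans (Subfield.le_adjoinSet _ _),
        Subfield.subset_adjoinSet _ _⟩
    have hgT := hmax ⟨Set.insert_subset hg hTG,
      hT.insert hp (hTG.trans hGM) (hGM hg) hg''⟩ (Set.subset_insert g T) (Set.mem_insert g T)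
    exact hg'' (Subfield.subset_closure (.inr hgT))
  have hsep (g : F) (hg : g ∈ G) : IsSeparable (L.adjoinSet T) g :=
    (isSeparable_of_subset_closure_pow (k.adjoinSet T) hGf hgen g hg).of_subfield_ringHom
      (RingHom.id F) (Subfield.adjoinSet_le.mpr
        ⟨hkL.trans (L.le_adjoinSet T), L.subset_adjoinSet T⟩)
  have hTL : AlgIndepOver L T := hfree T (hTG.trans hGK)
    (hT.algIndepOver hp hkK hsK (hTG.trans hGK) (hTG.trans hGM))
  refine hTL.pIndepOver_adjoinSet hp hsep s (hST ⟨hs, .inl rfl⟩) (Subfield.closure_mono ?_ hsG₀)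
  refine Set.union_subset_union (Set.union_subset_union_left _ (Set.image_mono
    (L.adjoinSet_mono (Set.subset_insert s G₀)))) ?_
  exact fun x ⟨hx, hxG⟩ ↦ ⟨hST ⟨hx.1, .inr hxG⟩, hx.2⟩
end

section
/- Let p be a prime, let (U, ∂) be a differentially perfect differential field of characteristic p (i.e., C_U = U^p), and let a₁, …, a_n ∈ U be pairwise distinct nonzero elements such that ∂(a_i) = a_i^{p^{k_i}+1} for some integers k_i ≥ 1 (1 ≤ i ≤ n). Then the subfield F_p(a₁, …, a_n) of U is a differential subfield (it is closed under ∂) and it is differentially perfect: its field of constants {x ∈ F_p(a₁, …, a_n) : ∂(x) = 0} equals F_p(a₁, …, a_n)^p. -/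
/-- The subfield of constants of a derivation of a field. -/
def Derivation.constantsSubfield {U : Type*} [Field U] (d : Derivation ℤ U U) : Subfield U where
  carrier := {x | d x = 0}
  mul_mem' {x y} hx hy := by
    simp only [Set.mem_ofPred_eq] at *
    simp [hx, hy]
  one_mem' := by simp
  add_mem' {x y} hx hy := by
    simp only [Set.mem_ofPred_eq] at *
    simp [hx, hy]
  zero_mem' := by simp
  neg_mem' {x} hx := by
    simp only [Set.mem_ofPred_eq] at *
    simp [hx]
  inv_mem' x hx := by
    simp only [Set.mem_ofPred_eq] at *
    simp [Derivation.leibniz_inv, hx]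

theorem Derivation.mem_constantsSubfield {U : Type*} [Field U] {d : Derivation ℤ U U} {x : U} :
    x ∈ d.constantsSubfield ↔ d x = 0 :=
  Iff.rfl

/-- A derivation of a field, as a linear endomorphism over its field of constants. -/
def Derivation.toConstantsEnd {U : Type*} [Field U] (d : Derivation ℤ U U) :
    Module.End d.constantsSubfield U where
  toFun := d
  map_add' := map_add d
  map_smul' c x := by
    have hc : d (c : U) = 0 := c.2
    simp [Subfield.smul_def, hc]

theorem Derivation.map_pow_char {p : ℕ} {U : Type*} [Field U] [CharP U p]
    (d : Derivation ℤ U U) (x : U) : d (x ^ p) = 0 := by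
  simp [Derivation.leibniz_pow]

theorem Derivation.map_pow_char_pow {p : ℕ} {U : Type*} [Field U] [CharP U p]
    (d : Derivation ℤ U U) (x : U) {e : ℕ} (he : 1 ≤ e) : d (x ^ p ^ e) = 0 := by
  obtain ⟨e, rfl⟩ := Nat.exists_eq_add_of_le' he
  rw [pow_succ, pow_mul]
  exact d.map_pow_char _

theorem natCast_pow_char_pow {p : ℕ} (hp : p.Prime) {U : Type*} [Field U] [CharP U p]
    (c e : ℕ) : (c : U) ^ p ^ e = c := by
  have := Fact.mk hp
  exact map_natCast (iterateFrobenius U p e) c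

/-- If `d w = w * b` with each `b i` a constant and the `b i` distinct, a vanishing sum of the
`w i` vanishes termwise. -/
theorem Derivation.eq_zero_of_sum_eq_zero {U : Type*} [Field U] (d : Derivation ℤ U U) {n : ℕ}
    {w b : Fin n → U} (hb : Function.Injective b) (hdb : ∀ i, d (b i) = 0)
    (hw : ∀ i, d (w i) = w i * b i) (hsum : ∑ i, w i = 0) : w = 0 := by
  have key : ∀ r : ℕ, ∑ i, w i * b i ^ r = 0 := by
    intro r
    induction r with
    | zero => simpa using hsum
    | succ r ih =>
      have h := congrArg d ih
      rw [map_sum, map_zero] at h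
      rw [← h]
      refine Finset.sum_congr rfl fun i _ => ?_
      simp [Derivation.leibniz_pow, hdb, hw]
      ring
  exact Matrix.eq_zero_of_forall_pow_sum_mul_pow_eq_zero hb fun i => key i

/-- The powers `aᵢ ^ p ^ kᵢ` of distinct nonzero solutions are linearly independent over the
prime field. -/
theorem natCast_eq_zero_of_sum_mul_pow_eq_zero
    {p : ℕ} (hp : p.Prime) {U : Type*} [Field U] [CharP U p]
    (d : Derivation ℤ U U) {n : ℕ} {a : Fin n → U}
    (hinj : Function.Injective a) (hne : ∀ i, a i ≠ 0)
    {k : Fin n → ℕ} (hk : ∀ i, 1 ≤ k i)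
    (hd : ∀ i, d (a i) = a i ^ (p ^ k i + 1))
    (c : Fin n → ℕ) (hc : ∑ i, (c i : U) * a i ^ p ^ k i = 0) (i : Fin n) : (c i : U) = 0 := by
  classical
  have := Fact.mk hp
  by_contra hi
  obtain ⟨j, hj, hmin⟩ := Finset.exists_min_image
    (Finset.univ.filter fun i => (c i : U) ≠ 0) k ⟨i, by simpa using hi⟩
  simp only [Finset.mem_filter, Finset.mem_univ, true_and] at hj hmin
  have hroot : ∑ i, (c i : U) * a i ^ p ^ (k i - k j) = 0 := by
    refine pow_eq_zero_iff (pow_ne_zero (k j) hp.ne_zero) |>.mp ?_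
    rw [sum_pow_char_pow, ← hc]
    refine Finset.sum_congr rfl fun i _ => ?_
    rw [mul_pow, natCast_pow_char_pow hp]
    by_cases h0 : (c i : U) = 0
    · simp [h0]
    · rw [← pow_mul, ← pow_add, Nat.sub_add_cancel (hmin i h0)]
  set w : Fin n → U := fun i =>
    if k i = k j then (c i : U) * a i ^ (p ^ k j + 1) else 0 with hw
  have hconst : ∀ i, d (a i ^ p ^ k j) = 0 := fun i => d.map_pow_char_pow _ (hk j)
  have hsum : ∑ i, w i = 0 := by
    have h := congrArg d hroot
    rw [map_sum, map_zero] at h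
    rw [← h]
    refine Finset.sum_congr rfl fun i _ => ?_
    by_cases h0 : (c i : U) = 0
    · simp [hw, h0]
    by_cases hij : k i = k j
    · simp [hw, hij, hd]
    · have : 1 ≤ k i - k j := by have := hmin i h0; omega
      simp [hw, hij, d.map_pow_char_pow _ this]
  have hzero := d.eq_zero_of_sum_eq_zero (w := w) (b := fun i => a i ^ p ^ k j)
    (fun x y hxy => hinj (iterateFrobenius_inj U p (k j) hxy)) hconst (fun i => by
      by_cases hij : k i = k j
      · simp only [hw, hij, if_true, pow_succ (a i), Derivation.leibniz, hconst, hd,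
          Derivation.map_natCast, smul_eq_mul]
        ring
      · simp [hw, hij]) hsum
  have hwj := congrFun hzero j
  simp [hw, hj, hne j] at hwj

theorem exists_logDeriv_of_mem_closure
    {p : ℕ} {U : Type*} [Field U] (d : Derivation ℤ U U) {n : ℕ} {a : Fin n → U}
    {k : Fin n → ℕ} (hd : ∀ i, d (a i) = a i ^ (p ^ k i + 1))
    {x : U} (hx : x ∈ Submonoid.closure (Set.range a)) :
    ∃ m : Fin n → ℕ, x = ∏ i, a i ^ m i ∧ d x = (∑ i, (m i : U) * a i ^ p ^ k i) * x := by
  classical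
  induction hx using Submonoid.closure_induction with
  | mem x hx =>
    obtain ⟨i, rfl⟩ := hx
    refine ⟨Pi.single i 1, ?_, ?_⟩
    · simp [Pi.single_apply, pow_ite]
    · simp [Pi.single_apply, hd, pow_succ]
  | one => exact ⟨0, by simp, by simp⟩
  | mul x y _ _ hx hy =>
    obtain ⟨m, hm, hdm⟩ := hx
    obtain ⟨l, hl, hdl⟩ := hy
    refine ⟨m + l, by simp [hm, hl, pow_add, Finset.prod_mul_distrib], ?_⟩
    simp only [Derivation.leibniz, smul_eq_mul, hdm, hdl, Pi.add_apply, Nat.cast_add, add_mul,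
      Finset.sum_add_distrib]
    ring

/-- A polynomial in the solutions is a `p`-th power plus a sum of eigenvectors of the derivation
with nonzero eigenvalues. -/
theorem exists_pow_add_of_mem_closure
    {p : ℕ} (hp : p.Prime) {U : Type*} [Field U] [CharP U p]
    (d : Derivation ℤ U U) {n : ℕ} {a : Fin n → U}
    (hinj : Function.Injective a) (hne : ∀ i, a i ≠ 0)
    {k : Fin n → ℕ} (hk : ∀ i, 1 ≤ k i)
    (hd : ∀ i, d (a i) = a i ^ (p ^ k i + 1))
    {x : U} (hx : x ∈ Subring.closure (Set.range a)) :
    ∃ y ∈ Subfield.closure (Set.range a),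
      ∃ v ∈ ⨆ μ, ⨆ _ : μ ≠ 0, d.toConstantsEnd.eigenspace μ, x = y ^ p + v := by
  have := Fact.mk hp
  rw [Subring.mem_closure_iff] at hx
  induction hx using AddSubgroup.closure_induction with
  | mem x hx =>
    obtain ⟨m, hm, hdm⟩ := exists_logDeriv_of_mem_closure d hd hx
    by_cases h0 : ∑ i, (m i : U) * a i ^ p ^ k i = 0
    · have hdvd : ∀ i, p ∣ m i := fun i => (CharP.cast_eq_zero_iff U p _).mp
        (natCast_eq_zero_of_sum_mul_pow_eq_zero hp d hinj hne hk hd m h0 i)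
      choose l hl using hdvd
      refine ⟨∏ i, a i ^ l i, prod_mem fun i _ => pow_mem (Subfield.subset_closure (Set.mem_range_self i)) _,
        0, zero_mem _, ?_⟩
      rw [hm, add_zero, ← Finset.prod_pow]
      refine Finset.prod_congr rfl fun i _ => ?_
      rw [hl i, ← pow_mul, mul_comm]
    · have hmem : ∑ i, (m i : U) * a i ^ p ^ k i ∈ d.constantsSubfield :=
        sum_mem fun i _ => mul_mem (natCast_mem _ _) (d.map_pow_char_pow _ (hk i))
      refine ⟨0, zero_mem _, x, ?_, by simp [hp.ne_zero]⟩
      refine Submodule.mem_iSup_of_mem ⟨_, hmem⟩ (Submodule.mem_iSup_of_mem ?_ ?_)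
      · exact fun h => h0 (congrArg Subtype.val h)
      · exact Module.End.mem_eigenspace_iff.mpr hdm
  | zero => exact ⟨0, zero_mem _, 0, zero_mem _, by simp [hp.ne_zero]⟩
  | add x y _ _ hx hy =>
    obtain ⟨s, hs, v, hv, rfl⟩ := hx
    obtain ⟨t, ht, u, hu, rfl⟩ := hy
    refine ⟨s + t, add_mem hs ht, v + u, add_mem hv hu, ?_⟩
    rw [add_pow_char]
    ring
  | neg x _ hx =>
    obtain ⟨s, hs, v, hv, rfl⟩ := hx
    refine ⟨-s, neg_mem hs, -v, neg_mem hv, ?_⟩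
    have h : (-s) ^ p = -s ^ p := map_neg (frobenius U p) s
    rw [h]
    ring

theorem exists_pow_eq_of_mem_closure_of_map_eq_zero
    {p : ℕ} (hp : p.Prime) {U : Type*} [Field U] [CharP U p]
    (d : Derivation ℤ U U) {n : ℕ} {a : Fin n → U}
    (hinj : Function.Injective a) (hne : ∀ i, a i ≠ 0)
    {k : Fin n → ℕ} (hk : ∀ i, 1 ≤ k i)
    (hd : ∀ i, d (a i) = a i ^ (p ^ k i + 1))
    {x : U} (hx : x ∈ Subring.closure (Set.range a)) (hdx : d x = 0) :
    ∃ y ∈ Subfield.closure (Set.range a), y ^ p = x := by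
  obtain ⟨y, hy, v, hv, rfl⟩ := exists_pow_add_of_mem_closure hp d hinj hne hk hd hx
  have hv0 : v ∈ d.toConstantsEnd.eigenspace 0 := by
    rw [Module.End.mem_eigenspace_iff, zero_smul]
    rwa [map_add, d.map_pow_char, zero_add] at hdx
  have := Submodule.disjoint_def.mp (d.toConstantsEnd.eigenspaces_iSupIndep 0) v hv0 hv
  exact ⟨y, hy, by simp [this]⟩

theorem Derivation.map_mem_subfieldClosure {U : Type*} [Field U] (d : Derivation ℤ U U)
    {s : Set U} (hs : ∀ x ∈ s, d x ∈ Subfield.closure s) {x : U}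
    (hx : x ∈ Subfield.closure s) : d x ∈ Subfield.closure s := by
  induction hx using Subfield.closure_induction with
  | mem x hx => exact hs x hx
  | one => simp
  | add x y _ _ hx hy => simpa using add_mem hx hy
  | neg x _ hx => simpa using hx
  | inv x hx' hx =>
    rw [Derivation.leibniz_inv]
    exact mul_mem (neg_mem (pow_mem (inv_mem hx') 2)) hx
  | mul x y hx' hy' hx hy =>
    simpa using add_mem (mul_mem hx' hy) (mul_mem hy' hx)

/-- Let `(U, d)` be a differentially perfect differential field of characteristic `p`
(i.e. `C_U = U^p`), and let `a₁, …, a_n` be pairwise distinct nonzero elements with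
`d(aᵢ) = aᵢ^(p^(kᵢ)+1)` for some `kᵢ ≥ 1`. Then the subfield `F_p(a₁, …, a_n)` of `U`
is a differential subfield, and it is differentially perfect: its field of constants
equals `F_p(a₁, …, a_n)^p`. -/
theorem solutions_generate_differentially_perfect_subfield
    {p : ℕ} (hp : p.Prime) {U : Type*} [Field U] [CharP U p]
    (d : Derivation ℤ U U)
    (hperf : {x : U | d x = 0} = Set.range (fun y : U => y ^ p))
    {n : ℕ} (a : Fin n → U)
    (hinj : Function.Injective a) (hne : ∀ i, a i ≠ 0)
    (k : Fin n → ℕ) (hk : ∀ i, 1 ≤ k i)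
    (hd : ∀ i, d (a i) = a i ^ (p ^ k i + 1)) :
    (∀ x ∈ Subfield.closure (Set.range a), d x ∈ Subfield.closure (Set.range a)) ∧
      {x : U | x ∈ Subfield.closure (Set.range a) ∧ d x = 0}
        = (fun y : U => y ^ p) '' ↑(Subfield.closure (Set.range a)) := by
  refine ⟨fun x hx => d.map_mem_subfieldClosure ?_ hx, Set.Subset.antisymm ?_ ?_⟩
  · rintro _ ⟨i, rfl⟩
    rw [hd]
    exact pow_mem (Subfield.subset_closure (Set.mem_range_self i)) _
  · rintro x ⟨hx, hdx⟩
    obtain ⟨f, hf, g, hg, rfl⟩ := Subfield.mem_closure_iff.mp hx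
    have hgK : g ∈ Subfield.closure (Set.range a) :=
      Subfield.subring_closure_le _ hg
    rcases eq_or_ne g 0 with rfl | hg0
    · exact ⟨0, zero_mem _, by simp [hp.ne_zero]⟩
    have hfg : f * g ^ (p - 1) = f / g * g ^ p := by
      obtain ⟨q, rfl⟩ := Nat.exists_eq_add_of_le' hp.one_le
      rw [Nat.add_sub_cancel, pow_succ]
      field_simp
    obtain ⟨y, hy, hyp⟩ := exists_pow_eq_of_mem_closure_of_map_eq_zero hp d hinj hne hk hd
      (mul_mem hf (pow_mem hg (p - 1))) (by
        rw [hfg, Derivation.leibniz, hdx, d.map_pow_char, smul_zero, smul_zero, add_zero])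
    refine ⟨y / g, div_mem hy hgK, ?_⟩
    simp only [div_pow, hyp, hfg]
    exact mul_div_cancel_right₀ _ (pow_ne_zero _ hg0)
  · rintro _ ⟨y, hy, rfl⟩
    exact ⟨pow_mem hy p, d.map_pow_char y⟩
end
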